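/- (Full traversal completeness) Let G be an IMM_sc-consistent execution graph and ⟨C, I⟩ a traversal configuration of G. Then G ⊢ ⟨C, I⟩ →* ⟨E, W⟩, i.e., the full traversal steps can reach the configuration in which every event is covered and every write is issued. -/

import Mathlib

/-! ## Basic definitions: events, labels, relations -/

abbrev Loc := ℕ
abbrev Val := ℕ

inductive Mode
  | rlx | acq | rel | acqrel | sc
deriving DecidableEq

inductive ExFlag
  | notex | ex
deriving DecidableEq

inductive Strength
  | normal | strong
deriving DecidableEq

inductive Label
  | read (o : Mode) (x : Loc) (v : Val) (s : ExFlag)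
  | write (o : Mode) (x : Loc) (v : Val) (st : Strength)
  | fence (o : Mode)
deriving DecidableEq

inductive Event
  | init (x : Loc)
  | ev (tid : ℕ) (sn : ℚ)
deriving DecidableEq

def Event.isInit : Event → Prop
  | .init _ => True
  | .ev _ _ => False

/-- the set of initialization events -/
def InitE : Set Event := {e | e.isInit}

/-- the `sequenced-before` partial order on events: initialization events precede all
non-initialization events, and events of the same thread are ordered by serial number -/
def evLt : Event → Event → Prop
  | .init _, .ev _ _ => True
  | .ev i n, .ev j m => i = j ∧ n < m
  | _, _ => False

abbrev REv := Event → Event → Prop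

/-- relational composition `r ; s` -/
def seqR (r s : REv) : REv := fun a c => ∃ b, r a b ∧ s b c

infixr:70 " ⬝ " => seqR

/-- identity relation on a set: `[A]` -/
def eqv (A : Set Event) : REv := fun a b => a = b ∧ a ∈ A

notation:max "⦗" A "⦘" => eqv A

/-- union of relations -/
def runion (r s : REv) : REv := fun a b => r a b ∨ s a b

infixl:65 " ∪ᵣ " => runion

/-- reflexive closure `r^?` -/
def rcl (r : REv) : REv := fun a b => a = b ∨ r a b

/-- transitive closure `r⁺` -/
def tcl (r : REv) : REv := Relation.TransGen r

/-- reflexive-transitive closure `r*` -/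
def rtcl (r : REv) : REv := Relation.ReflTransGen r

/-- inverse relation `r⁻¹` -/
def transp (r : REv) : REv := fun a b => r b a

def rdom (r : REv) : Set Event := {a | ∃ b, r a b}

def rcodom (r : REv) : Set Event := {b | ∃ a, r a b}

/-- immediate edges: `imm(r) = r ∖ r;r` -/
def immediate (r : REv) : REv := fun a b => r a b ∧ ¬ (r ⬝ r) a b

def acyclic (r : REv) : Prop := Irreflexive (tcl r)

/-- `r` totally orders `A` -/
def totalOn (A : Set Event) (r : REv) : Prop :=
  ∀ a ∈ A, ∀ b ∈ A, a ≠ b → r a b ∨ r b a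

def Label.locOf : Label → Option Loc
  | .read _ x _ _ => some x
  | .write _ x _ _ => some x
  | .fence _ => none

def Label.valOf : Label → Option Val
  | .read _ _ v _ => some v
  | .write _ _ v _ => some v
  | .fence _ => none

/-! ## IMM execution graphs -/

structure Execution where
  E : Set Event
  lab : Event → Label
  rmw : REv
  data : REv
  addr : REv
  ctrl : REv
  casdep : REv
  rf : REv
  co : REv

namespace Execution

variable (G : Execution)

def loc (e : Event) : Option Loc := (G.lab e).locOf
def valu (e : Event) : Option Val := (G.lab e).valOf

/-- read events -/
def R : Set Event := {e | e ∈ G.E ∧ ∃ o x v s, G.lab e = .read o x v s}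
/-- write events -/
def W : Set Event := {e | e ∈ G.E ∧ ∃ o x v st, G.lab e = .write o x v st}
/-- fence events -/
def F : Set Event := {e | e ∈ G.E ∧ ∃ o, G.lab e = .fence o}
/-- acquire reads -/
def Racq : Set Event := {e | e ∈ G.E ∧ ∃ x v s, G.lab e = .read .acq x v s}
/-- exclusive reads -/
def Rex : Set Event := {e | e ∈ G.E ∧ ∃ o x v, G.lab e = .read o x v .ex}
/-- release writes -/
def Wrel : Set Event := {e | e ∈ G.E ∧ ∃ x v st, G.lab e = .write .rel x v st}
/-- strong writes -/
def Wstrong : Set Event := {e | e ∈ G.E ∧ ∃ o x v, G.lab e = .write o x v .strong}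
/-- writes to location `x` -/
def Wloc (x : Loc) : Set Event := {e | e ∈ G.W ∧ G.loc e = some x}
/-- reads from location `x` -/
def Rloc (x : Loc) : Set Event := {e | e ∈ G.R ∧ G.loc e = some x}
/-- SC fences -/
def Fsc : Set Event := {e | e ∈ G.E ∧ G.lab e = .fence .sc}
/-- fences of mode exactly `rel` -/
def Frel : Set Event := {e | e ∈ G.E ∧ G.lab e = .fence .rel}
/-- fences whose mode is at least `rel` (i.e. `rel`, `acqrel` or `sc`) -/
def FgeRel : Set Event :=
  {e | e ∈ G.E ∧ (G.lab e = .fence .rel ∨ G.lab e = .fence .acqrel ∨ G.lab e = .fence .sc)}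
/-- fences whose mode is at least `acq` (i.e. `acq`, `acqrel` or `sc`) -/
def FgeAcq : Set Event :=
  {e | e ∈ G.E ∧ (G.lab e = .fence .acq ∨ G.lab e = .fence .acqrel ∨ G.lab e = .fence .sc)}

/-- program order -/
def po : REv := fun a b => a ∈ G.E ∧ b ∈ G.E ∧ evLt a b

/-- both events access the same location -/
def sameLoc : REv := fun a b => ∃ x, G.loc a = some x ∧ G.loc b = some x

/-- `po|loc` -/
def poloc : REv := fun a b => G.po a b ∧ G.sameLoc a b

def rfi : REv := fun a b => G.rf a b ∧ G.po a b
def rfe : REv := fun a b => G.rf a b ∧ ¬ G.po a b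
def coi : REv := fun a b => G.co a b ∧ G.po a b
def coe : REv := fun a b => G.co a b ∧ ¬ G.po a b

/-- from-read -/
def fr : REv := transp G.rf ⬝ G.co
def fri : REv := fun a b => G.fr a b ∧ G.po a b
def fre : REv := fun a b => G.fr a b ∧ ¬ G.po a b

/-- release sequence -/
def rs : REv :=
  ⦗G.W⦘ ⬝ G.poloc ⬝ ⦗G.W⦘ ∪ᵣ ⦗G.W⦘ ⬝ rtcl (rcl G.poloc ⬝ G.rf ⬝ G.rmw)

/-- release prefix -/
def release : REv := (⦗G.Wrel⦘ ∪ᵣ ⦗G.FgeRel⦘ ⬝ G.po) ⬝ G.rs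

/-- synchronizes with -/
def sw : REv :=
  G.release ⬝ (G.rfi ∪ᵣ rcl G.poloc ⬝ G.rfe) ⬝ (⦗G.Racq⦘ ∪ᵣ G.po ⬝ ⦗G.FgeAcq⦘)

/-- happens-before -/
def hb : REv := tcl (G.po ∪ᵣ G.sw)

/-- extended coherence order -/
def eco : REv := G.rf ∪ᵣ G.co ⬝ rcl G.rf ∪ᵣ G.fr ⬝ rcl G.rf

/-- barrier order -/
def bob : REv :=
  G.po ⬝ ⦗G.Wrel⦘ ∪ᵣ ⦗G.Racq⦘ ⬝ G.po ∪ᵣ G.po ⬝ ⦗G.F⦘ ∪ᵣ ⦗G.F⦘ ⬝ G.po ∪ᵣ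
    ⦗G.Wrel⦘ ⬝ G.poloc ⬝ ⦗G.W⦘

/-- syntactic dependencies -/
def deps : REv :=
  G.data ∪ᵣ G.ctrl ∪ᵣ G.addr ⬝ rcl G.po ∪ᵣ G.casdep ∪ᵣ ⦗G.Rex⦘ ⬝ G.po

/-- preserved program order -/
def ppo : REv := ⦗G.R⦘ ⬝ tcl (G.deps ∪ᵣ G.rfi) ⬝ ⦗G.W⦘

def detour : REv := fun a b => (G.coe ⬝ G.rfe) a b ∧ G.po a b

/-- partial SC fence order -/
def psc : REv := ⦗G.Fsc⦘ ⬝ G.hb ⬝ G.eco ⬝ G.hb ⬝ ⦗G.Fsc⦘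

/-- the acyclicity relation of IMM -/
def ar : REv :=
  G.rfe ∪ᵣ G.bob ∪ᵣ G.ppo ∪ᵣ G.detour ∪ᵣ G.psc ∪ᵣ ⦗G.Wstrong⦘ ⬝ G.po ⬝ ⦗G.W⦘

/-! RC11-style variants -/

def rsRC11 : REv := ⦗G.W⦘ ⬝ rcl G.poloc ⬝ rtcl (G.rf ⬝ G.rmw)

def releaseRC11 : REv := (⦗G.Wrel⦘ ∪ᵣ ⦗G.FgeRel⦘ ⬝ G.po) ⬝ G.rsRC11

def swRC11 : REv := G.releaseRC11 ⬝ G.rf ⬝ (⦗G.Racq⦘ ∪ᵣ G.po ⬝ ⦗G.FgeAcq⦘)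

def hbRC11 : REv := tcl (G.po ∪ᵣ G.swRC11)

end Execution

/-- Well-formedness of an IMM execution graph -/
structure ExecWf (G : Execution) : Prop where
  finE : G.E.Finite
  init_lab : ∀ x, Event.init x ∈ G.E →
    G.lab (Event.init x) = Label.write .rlx x 0 .normal
  read_mode : ∀ e ∈ G.E, ∀ o x v s, G.lab e = .read o x v s → o = Mode.rlx ∨ o = Mode.acq
  write_mode : ∀ e ∈ G.E, ∀ o x v st, G.lab e = .write o x v st → o = Mode.rlx ∨ o = Mode.rel
  fence_mode : ∀ e ∈ G.E, ∀ o, G.lab e = .fence o →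
    o = Mode.acq ∨ o = Mode.rel ∨ o = Mode.acqrel ∨ o = Mode.sc
  rmw_sub : ∀ a b, G.rmw a b → a ∈ G.Rex ∧ b ∈ G.W ∧ G.sameLoc a b ∧ immediate G.po a b
  strong_rmw : G.Wstrong ⊆ rcodom G.rmw
  data_sub : ∀ a b, G.data a b → a ∈ G.R ∧ G.po a b ∧ b ∈ G.W
  addr_sub : ∀ a b, G.addr a b → a ∈ G.R ∧ G.po a b ∧ (b ∈ G.R ∨ b ∈ G.W)
  ctrl_sub : ∀ a b, G.ctrl a b → a ∈ G.R ∧ G.po a b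
  ctrl_po : ∀ a b c, G.ctrl a b → G.po b c → G.ctrl a c
  casdep_sub : ∀ a b, G.casdep a b → a ∈ G.R ∧ G.po a b ∧ b ∈ G.Rex
  rf_sub : ∀ a b, G.rf a b → a ∈ G.W ∧ b ∈ G.R ∧ G.sameLoc a b
  rf_val : ∀ a b, G.rf a b → G.valu a = G.valu b
  rf_func : ∀ a b c, G.rf a c → G.rf b c → a = b
  co_sub : ∀ a b, G.co a b → a ∈ G.W ∧ b ∈ G.W ∧ G.sameLoc a b
  co_trans : Transitive G.co
  co_irr : Irreflexive G.co

/-- IMM-consistency (Definition 3.1) -/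
def IMMConsistent (G : Execution) : Prop :=
  rcodom G.rf = G.R ∧
  (∀ x, totalOn (G.Wloc x) G.co) ∧
  Irreflexive (G.hb ⬝ rcl G.eco) ∧
  (∀ a b, G.rmw a b → ¬ (G.fre ⬝ G.coe) a b) ∧
  acyclic G.ar

/-! ## IMM with a total order on SC fences (IMM_sc) -/

/-- `sc` is a strict total order on the SC fences of `G` -/
def scWf (G : Execution) (sc : REv) : Prop :=
  (∀ a b, sc a b → a ∈ G.Fsc ∧ b ∈ G.Fsc) ∧
  Transitive sc ∧ Irreflexive sc ∧ totalOn G.Fsc sc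

/-- `ar_sc`: the acyclicity relation of IMM with `psc` replaced by `sc` -/
def arSC (G : Execution) (sc : REv) : REv :=
  G.rfe ∪ᵣ G.bob ∪ᵣ G.ppo ∪ᵣ G.detour ∪ᵣ sc ∪ᵣ ⦗G.Wstrong⦘ ⬝ G.po ⬝ ⦗G.W⦘

/-- IMM_sc-consistency (the variant using `hb_RC11`). -/
def IMMscConsistent (G : Execution) (sc : REv) : Prop :=
  rcodom G.rf = G.R ∧
  (∀ x, totalOn (G.Wloc x) G.co) ∧
  Irreflexive (G.hbRC11 ⬝ rcl G.eco) ∧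
  (∀ a b, G.rmw a b → ¬ (G.fre ⬝ G.coe) a b) ∧
  acyclic (arSC G sc) ∧
  Irreflexive (sc ⬝ G.hbRC11 ⬝ rcl (G.eco ⬝ G.hbRC11))

/-! ## Full traversal -/

/-- Issuable events (full model). -/
def FIssuable (G : Execution) (C I : Set Event) : Set Event :=
  {w | w ∈ G.W ∧
    (∀ a, (⦗G.Wrel⦘ ⬝ G.poloc ∪ᵣ ⦗G.F⦘ ⬝ G.po) a w → a ∈ C) ∧
    (∀ a, ((G.detour ∪ᵣ G.rfe) ⬝ G.ppo) a w → a ∈ I) ∧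
    (∀ a, ((G.detour ∪ᵣ G.rfe) ⬝ ⦗G.Racq⦘ ⬝ G.po) a w → a ∈ I) ∧
    (∀ a, (⦗G.Wstrong⦘ ⬝ G.po) a w → a ∈ I)}

/-- Coverable events (full model). -/
def FCoverable (G : Execution) (sc : REv) (C I : Set Event) : Set Event :=
  {e | e ∈ G.E ∧ (∀ a, G.po a e → a ∈ C) ∧
    ((e ∈ G.W ∧ e ∈ I) ∨
     (e ∈ G.R ∧ ∀ a, G.rf a e → a ∈ I) ∨
     (e ∈ G.F ∧ e ∉ G.Fsc) ∨
     (e ∈ G.Fsc ∧ ∀ a, sc a e → a ∈ C))}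

/-- `⟨C, I⟩` is a traversal configuration of `G`. -/
def TravConfig (G : Execution) (sc : REv) (C I : Set Event) : Prop :=
  G.E ∩ InitE ⊆ C ∧
  C ⊆ FCoverable G sc C I ∧
  I ⊆ FIssuable G C I ∧
  C ∩ G.W ⊆ I ∧
  I ∩ G.Wrel ⊆ C ∧
  rcodom (⦗C⦘ ⬝ G.rmw) ⊆ C

/-- The (full) traversal steps of Figure 8. -/
inductive TravStep (G : Execution) (sc : REv) :
    Set Event × Set Event → Set Event × Set Event → Prop
  | issue {C I : Set Event} {w : Event} :
      w ∈ FIssuable G C I → w ∉ G.Wrel → w ∉ I →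
      TravStep G sc (C, I) (C, insert w I)
  | cover {C I : Set Event} {e : Event} :
      e ∈ FCoverable G sc C I → (∀ b, ¬ G.rmw e b) → e ∉ C →
      TravStep G sc (C, I) (insert e C, I)
  | releaseCover {C I : Set Event} {w : Event} :
      w ∈ G.Wrel → (∀ a, G.po a w → a ∈ C) → w ∉ C → w ∉ I →
      TravStep G sc (C, I) (insert w C, insert w I)
  | rmwCover {C I I' : Set Event} {r w : Event} :
      r ∈ FCoverable G sc C I → G.rmw r w → r ∉ C → w ∉ C →
      ((w ∈ I ∧ I' = I) ∨ (w ∈ G.Wrel ∧ w ∉ I ∧ I' = insert w I)) →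
      TravStep G sc (C, I) (insert r (insert w C), I')

theorem evLt_trans {a b c : Event} (h : evLt a b) (h' : evLt b c) : evLt a c := by
  cases a <;> cases b <;> cases c <;> simp only [evLt] at *
  exact ⟨h.1.trans h'.1, h.2.trans h'.2⟩

theorem evLt_irrefl (a : Event) : ¬ evLt a a := by
  cases a <;> simp [evLt]

/-- Two events preceding the same event are comparable, unless the second is an
initialization event. -/
theorem evLt_comparable {a b c : Event} (hb : b ∉ InitE) (hac : evLt a c) (hbc : evLt b c) :
    a = b ∨ evLt a b ∨ evLt b a := by
  cases a <;> cases b <;> cases c <;> simp_all [evLt, InitE, Event.isInit]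
  grind

theorem exists_minimal_of_finite {r : REv} (htr : Transitive r) (hir : Irreflexive r)
    {S : Set Event} (hfin : S.Finite) (hne : S.Nonempty) :
    ∃ m ∈ S, ∀ x ∈ S, ¬ r x m := by
  have : Std.Irrefl r := ⟨hir⟩
  have : IsTrans Event r := ⟨htr⟩
  have : IsStrictOrder Event r := {}
  have : Nonempty S := hne.to_subtype
  obtain ⟨m, -, hmin⟩ := (hfin.wellFoundedOn (r := r)).has_min Set.univ Set.univ_nonempty
  exact ⟨m, m.2, fun x hx => hmin ⟨x, hx⟩ (Set.mem_univ _)⟩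

namespace Execution

variable {G : Execution}

theorem po_trans : Transitive G.po :=
  fun _ _ _ h h' => ⟨h.1, h'.2.1, evLt_trans h.2.2 h'.2.2⟩

theorem po_irrefl : Irreflexive G.po := fun a h => evLt_irrefl a h.2.2

theorem mem_R_or_W_or_F {e : Event} (he : e ∈ G.E) : e ∈ G.R ∨ e ∈ G.W ∨ e ∈ G.F := by
  cases h : G.lab e with
  | read o x v s => exact .inl ⟨he, _, _, _, _, h⟩
  | write o x v s => exact .inr (.inl ⟨he, _, _, _, _, h⟩)
  | fence o => exact .inr (.inr ⟨he, _, h⟩)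

theorem not_mem_W_of_mem_R {e : Event} (h : e ∈ G.R) : e ∉ G.W := by
  rintro ⟨_, _, _, _, _, h'⟩
  obtain ⟨_, _, _, _, _, h⟩ := h
  simp [h] at h'

theorem not_mem_F_of_mem_R {e : Event} (h : e ∈ G.R) : e ∉ G.F := by
  rintro ⟨_, _, h'⟩
  obtain ⟨_, _, _, _, _, h⟩ := h
  simp [h] at h'

theorem not_mem_F_of_mem_W {e : Event} (h : e ∈ G.W) : e ∉ G.F := by
  rintro ⟨_, _, h'⟩
  obtain ⟨_, _, _, _, _, h⟩ := h
  simp [h] at h'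

theorem Wrel_subset_W : G.Wrel ⊆ G.W := fun _ ⟨h, _, _, _, h'⟩ => ⟨h, _, _, _, _, h'⟩

theorem Wstrong_subset_W : G.Wstrong ⊆ G.W := fun _ ⟨h, _, _, _, h'⟩ => ⟨h, _, _, _, _, h'⟩

theorem Racq_subset_R : G.Racq ⊆ G.R := fun _ ⟨h, _, _, _, h'⟩ => ⟨h, _, _, _, _, h'⟩

theorem Rex_subset_R : G.Rex ⊆ G.R := fun _ ⟨h, _, _, _, h'⟩ => ⟨h, _, _, _, _, h'⟩

theorem Fsc_subset_F : G.Fsc ⊆ G.F := fun _ ⟨h, h'⟩ => ⟨h, _, h'⟩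

end Execution

namespace ExecWf

open Execution

variable {G : Execution}

theorem not_mem_InitE_of_mem_R (hwf : ExecWf G) {e : Event} (h : e ∈ G.R) : e ∉ InitE := by
  obtain ⟨he, _, _, _, _, h⟩ := h
  cases e with
  | init x => simp [hwf.init_lab x he] at h
  | ev i n => simp [InitE, Event.isInit]

theorem deps_subset_po (hwf : ExecWf G) {a b : Event} (h : G.deps a b) : G.po a b := by
  rcases h with (((h | h) | ⟨c, h, h'⟩) | h) | ⟨c, ⟨rfl, _⟩, h⟩
  · exact (hwf.data_sub _ _ h).2.1
  · exact (hwf.ctrl_sub _ _ h).2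
  · rcases h' with rfl | h'
    · exact (hwf.addr_sub _ _ h).2.1
    · exact po_trans (hwf.addr_sub _ _ h).2.1 h'
  · exact (hwf.casdep_sub _ _ h).2.1
  · exact h

theorem ppo_subset (hwf : ExecWf G) {a b : Event} (h : G.ppo a b) : a ∈ G.R ∧ G.po a b := by
  obtain ⟨_, ⟨rfl, ha⟩, _, h, rfl, -⟩ := h
  refine ⟨ha, ?_⟩
  have step : ∀ x y, (G.deps ∪ᵣ G.rfi) x y → G.po x y :=
    fun x y hxy => hxy.elim hwf.deps_subset_po And.right
  induction h with
  | single h => exact step _ _ h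
  | tail _ h ih => exact po_trans ih (step _ _ h)

theorem mem_W_of_detour_or_rfe (hwf : ExecWf G) {a b : Event}
    (h : (G.detour ∪ᵣ G.rfe) a b) : a ∈ G.W := by
  rcases h with ⟨⟨_, h, _⟩, _⟩ | h
  · exact (hwf.co_sub _ _ h.1).1
  · exact (hwf.rf_sub _ _ h.1).1

/-- The predecessors of the write of an RMW pair are its read and the predecessors of
that read. -/
theorem eq_or_po_of_rmw (hwf : ExecWf G) {r w a : Event} (h : G.rmw r w) (ha : G.po a w) :
    a = r ∨ G.po a r := by
  obtain ⟨hr, -, -, hpo, himm⟩ := hwf.rmw_sub _ _ h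
  rcases evLt_comparable (hwf.not_mem_InitE_of_mem_R (Rex_subset_R hr)) ha.2.2 hpo.2.2 with
    h | h | h
  · exact .inl h
  · exact .inr ⟨ha.1, hpo.1, h⟩
  · exact absurd ⟨a, ⟨hpo.1, ha.1, h⟩, ha⟩ himm

theorem rmw_functional (hwf : ExecWf G) {r w w' : Event} (h : G.rmw r w) (h' : G.rmw r w') :
    w = w' := by
  obtain ⟨hr, -, -, hpo, himm⟩ := hwf.rmw_sub _ _ h
  obtain ⟨-, -, -, hpo', himm'⟩ := hwf.rmw_sub _ _ h'
  have hinit := hwf.not_mem_InitE_of_mem_R (Rex_subset_R hr)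
  have hcomp : w = w' ∨ evLt w w' ∨ evLt w' w := by
    have h₁ := hpo.2.2
    have h₂ := hpo'.2.2
    cases r <;> cases w <;> cases w' <;> simp_all [evLt, InitE, Event.isInit]
    grind
  rcases hcomp with h | h | h
  · exact h
  · exact absurd ⟨w, hpo, hpo.2.1, hpo'.2.1, h⟩ himm'
  · exact absurd ⟨w', hpo', hpo'.2.1, hpo.2.1, h⟩ himm

end ExecWf

section Traversal

open Execution

variable {G : Execution} {sc : REv} {C I C' I' : Set Event}

theorem FCoverable_mono (hC : C ⊆ C') (hI : I ⊆ I') :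
    FCoverable G sc C I ⊆ FCoverable G sc C' I' := by
  rintro e ⟨he, hpo, h⟩
  refine ⟨he, fun a ha => hC (hpo a ha), ?_⟩
  rcases h with h | h | h | h
  · exact .inl ⟨h.1, hI h.2⟩
  · exact .inr (.inl ⟨h.1, fun a ha => hI (h.2 a ha)⟩)
  · exact .inr (.inr (.inl h))
  · exact .inr (.inr (.inr ⟨h.1, fun a ha => hC (h.2 a ha)⟩))

theorem FIssuable_mono (hC : C ⊆ C') (hI : I ⊆ I') :
    FIssuable G C I ⊆ FIssuable G C' I' :=
  fun _ ⟨hw, h₁, h₂, h₃, h₄⟩ => ⟨hw, fun a h => hC (h₁ a h), fun a h => hI (h₂ a h),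
    fun a h => hI (h₃ a h), fun a h => hI (h₄ a h)⟩

namespace TravConfig

theorem subset_E (h : TravConfig G sc C I) : C ⊆ G.E := fun _ he => (h.2.1 he).1

theorem subset_W (h : TravConfig G sc C I) : I ⊆ G.W := fun _ hw => (h.2.2.1 hw).1

theorem mem_of_po (h : TravConfig G sc C I) {a e : Event} (he : e ∈ C) (ha : G.po a e) :
    a ∈ C := (h.2.1 he).2.1 a ha

theorem rf_issued (h : TravConfig G sc C I) {a r : Event} (hr : r ∈ C) (hR : r ∈ G.R)
    (ha : G.rf a r) : a ∈ I := by
  rcases (h.2.1 hr).2.2 with h | h | h | h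
  · exact absurd h.1 (not_mem_W_of_mem_R hR)
  · exact h.2 a ha
  · exact absurd h.1 (not_mem_F_of_mem_R hR)
  · exact absurd (Fsc_subset_F h.1) (not_mem_F_of_mem_R hR)

/-- Extending a traversal configuration by coverable and issuable events. -/
theorem extend (h : TravConfig G sc C I) (hC : C ⊆ C') (hI : I ⊆ I')
    (hcov : ∀ e ∈ C', e ∉ C → e ∈ FCoverable G sc C' I')
    (hiss : ∀ w ∈ I', w ∉ I → w ∈ FIssuable G C' I')
    (hW : ∀ e ∈ C', e ∉ C → e ∈ G.W → e ∈ I')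
    (hrel : ∀ w ∈ I', w ∉ I → w ∈ G.Wrel → w ∈ C')
    (hrmw : ∀ r ∈ C', r ∉ C → ∀ w, G.rmw r w → w ∈ C') :
    TravConfig G sc C' I' := by
  obtain ⟨h₁, h₂, h₃, h₄, h₅, h₆⟩ := h
  refine ⟨h₁.trans hC, fun e he => ?_, fun w hw => ?_, fun e he => ?_, fun w hw => ?_, ?_⟩
  · by_cases heC : e ∈ C
    · exact FCoverable_mono hC hI (h₂ heC)
    · exact hcov e he heC
  · by_cases hwI : w ∈ I
    · exact FIssuable_mono hC hI (h₃ hwI)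
    · exact hiss w hw hwI
  · by_cases heC : e ∈ C
    · exact hI (h₄ ⟨heC, he.2⟩)
    · exact hW e he.1 heC he.2
  · by_cases hwI : w ∈ I
    · exact hC (h₅ ⟨hwI, hw.2⟩)
    · exact hrel w hw.1 hwI hw.2
  · rintro w ⟨r, _, ⟨rfl, hr⟩, hw⟩
    by_cases hrC : r ∈ C
    · exact hC (h₆ ⟨r, r, ⟨rfl, hrC⟩, hw⟩)
    · exact hrmw r hr hrC w hw

/-- A write is issuable once each of its predecessors is either covered or a coverable
read. -/
theorem issuable_of_po (h : TravConfig G sc C I) (hwf : ExecWf G) {w : Event} (hw : w ∈ G.W)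
    (hpre : ∀ a, G.po a w → a ∈ C ∨ a ∈ G.R ∧ a ∈ FCoverable G sc C I) :
    w ∈ FIssuable G C I := by
  have hread : ∀ a b, (G.detour ∪ᵣ G.rfe) a b → b ∈ G.R → G.po b w → a ∈ I := by
    intro a b hab hb hbw
    have ha := hwf.mem_W_of_detour_or_rfe hab
    rcases hab with ⟨-, hab⟩ | ⟨hab, -⟩
    · refine h.2.2.2.1 ⟨?_, ha⟩
      rcases hpre b hbw with hbC | ⟨-, hb⟩
      · exact h.mem_of_po hbC hab
      · exact hb.2.1 a hab
    · rcases hpre b hbw with hbC | ⟨-, hbc⟩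
      · exact h.rf_issued hbC hb hab
      · rcases hbc.2.2 with h | h | h | h
        · exact absurd h.1 (not_mem_W_of_mem_R hb)
        · exact h.2 a hab
        · exact absurd h.1 (not_mem_F_of_mem_R hb)
        · exact absurd (Fsc_subset_F h.1) (not_mem_F_of_mem_R hb)
  have hwrite : ∀ a ∈ G.W, G.po a w → a ∈ C := fun a ha haw =>
    (hpre a haw).resolve_right fun h => not_mem_W_of_mem_R h.1 ha
  refine ⟨hw, ?_, ?_, ?_, ?_⟩
  · rintro a (⟨_, ⟨rfl, ha⟩, haw, -⟩ | ⟨_, ⟨rfl, ha⟩, haw⟩)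
    · exact hwrite a (Wrel_subset_W ha) haw
    · exact (hpre a haw).resolve_right fun h => not_mem_F_of_mem_R h.1 ha
  · rintro a ⟨b, hab, hbw⟩
    exact hread a b hab (hwf.ppo_subset hbw).1 (hwf.ppo_subset hbw).2
  · rintro a ⟨b, hab, _, ⟨rfl, hb⟩, hbw⟩
    exact hread a b hab (Racq_subset_R hb) hbw
  · rintro a ⟨_, ⟨rfl, ha⟩, haw⟩
    exact h.2.2.2.1 ⟨hwrite a (Wstrong_subset_W ha) haw, Wstrong_subset_W ha⟩

end TravConfig

/-- Some traversal step leads to a strictly larger traversal configuration. -/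
def CanAdvance (G : Execution) (sc : REv) (C I : Set Event) : Prop :=
  ∃ C' I', TravStep G sc (C, I) (C', I') ∧ TravConfig G sc C' I' ∧
    C ⊆ C' ∧ I ⊆ I' ∧ ¬ (C' ⊆ C ∧ I' ⊆ I)

namespace TravConfig

theorem canAdvance_of_issuable (h : TravConfig G sc C I) {w : Event}
    (hw : w ∈ FIssuable G C I) (hrel : w ∉ G.Wrel) (hwI : w ∉ I) :
    CanAdvance G sc C I := by
  have hI : I ⊆ insert w I := Set.subset_insert _ _
  refine ⟨C, insert w I, .issue hw hrel hwI, h.extend subset_rfl hI ?_ ?_ ?_ ?_ ?_,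
    subset_rfl, hI, fun h' => hwI (h'.2 (Set.mem_insert _ _))⟩
  · exact fun e he he' => absurd he he'
  · rintro v (rfl | hv) hv'
    · exact FIssuable_mono subset_rfl hI hw
    · exact absurd hv hv'
  · exact fun e he he' => absurd he he'
  · rintro v (rfl | hv) hv' hv''
    · exact absurd hv'' hrel
    · exact absurd hv hv'
  · exact fun e he he' => absurd he he'

theorem canAdvance_of_coverable (h : TravConfig G sc C I) {e : Event}
    (he : e ∈ FCoverable G sc C I) (hrmw : ∀ b, ¬ G.rmw e b) (heC : e ∉ C)
    (hW : e ∈ G.W → e ∈ I) : CanAdvance G sc C I := by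
  have hC : C ⊆ insert e C := Set.subset_insert _ _
  refine ⟨insert e C, I, .cover he hrmw heC, h.extend hC subset_rfl ?_ ?_ ?_ ?_ ?_,
    hC, subset_rfl, fun h' => heC (h'.1 (Set.mem_insert _ _))⟩
  · rintro v (rfl | hv) hv'
    · exact FCoverable_mono hC subset_rfl he
    · exact absurd hv hv'
  · exact fun e he he' => absurd he he'
  · rintro v (rfl | hv) hv' hv''
    · exact hW hv''
    · exact absurd hv hv'
  · exact fun e he he' => absurd he he'
  · rintro v (rfl | hv) hv' w hw
    · exact absurd hw (hrmw w)
    · exact absurd hv hv'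

theorem canAdvance_of_next_write (h : TravConfig G sc C I) (hwf : ExecWf G) {w : Event}
    (hw : w ∈ G.W) (hwC : w ∉ C) (hpre : ∀ a, G.po a w → a ∈ C) :
    CanAdvance G sc C I := by
  have hrmw : ∀ b, ¬ G.rmw w b := fun b hb =>
    not_mem_W_of_mem_R (Rex_subset_R (hwf.rmw_sub _ _ hb).1) hw
  by_cases hwI : w ∈ I
  · exact h.canAdvance_of_coverable ⟨hw.1, hpre, .inl ⟨hw, hwI⟩⟩ hrmw hwC fun _ => hwI
  have hiss := h.issuable_of_po hwf hw fun a ha => .inl (hpre a ha)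
  by_cases hrel : w ∈ G.Wrel
  · have hC : C ⊆ insert w C := Set.subset_insert _ _
    have hI : I ⊆ insert w I := Set.subset_insert _ _
    refine ⟨insert w C, insert w I, .releaseCover hrel hpre hwC hwI,
      h.extend hC hI ?_ ?_ ?_ ?_ ?_, hC, hI, fun h' => hwC (h'.1 (Set.mem_insert _ _))⟩
    · rintro v (rfl | hv) hv'
      · exact ⟨hw.1, fun a ha => hC (hpre a ha), .inl ⟨hw, Set.mem_insert _ _⟩⟩
      · exact absurd hv hv'
    · rintro v (rfl | hv) hv'
      · exact FIssuable_mono hC hI hiss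
      · exact absurd hv hv'
    · rintro v (rfl | hv) hv' -
      · exact Set.mem_insert _ _
      · exact absurd hv hv'
    · rintro v (rfl | hv) hv' -
      · exact Set.mem_insert _ _
      · exact absurd hv hv'
    · rintro v (rfl | hv) hv' b hb
      · exact absurd hb (hrmw b)
      · exact absurd hv hv'
  · exact h.canAdvance_of_issuable hiss hrel hwI

theorem canAdvance_of_next_read (h : TravConfig G sc C I) (hwf : ExecWf G) {r : Event}
    (hr : r ∈ G.R) (hrC : r ∉ C) (hcov : r ∈ FCoverable G sc C I) :
    CanAdvance G sc C I := by
  by_cases hex : ∃ w, G.rmw r w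
  swap
  · exact h.canAdvance_of_coverable hcov (not_exists.mp hex) hrC
      fun hw => absurd hw (not_mem_W_of_mem_R hr)
  obtain ⟨w, hrw⟩ := hex
  obtain ⟨-, hw, -, hpo, -⟩ := hwf.rmw_sub _ _ hrw
  have hwC : w ∉ C := fun hwC => hrC (h.mem_of_po hwC hpo)
  have hiss : w ∈ FIssuable G C I := h.issuable_of_po hwf hw fun a ha => by
    rcases hwf.eq_or_po_of_rmw hrw ha with rfl | ha
    · exact .inr ⟨hr, hcov⟩
    · exact .inl (hcov.2.1 a ha)
  have hC : C ⊆ insert r (insert w C) := fun _ hx => .inr (.inr hx)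
  have advance : ∀ I', I ⊆ I' → I' ⊆ insert w I → w ∈ I' →
      TravStep G sc (C, I) (insert r (insert w C), I') → CanAdvance G sc C I := by
    intro I' hI hI' hwI' hstep
    refine ⟨_, I', hstep, h.extend hC hI ?_ ?_ ?_ ?_ ?_, hC, hI,
      fun h' => hrC (h'.1 (Set.mem_insert _ _))⟩
    · rintro v (rfl | rfl | hv) hv'
      · exact FCoverable_mono hC hI hcov
      · refine ⟨hw.1, fun a ha => ?_, .inl ⟨hw, hwI'⟩⟩
        rcases hwf.eq_or_po_of_rmw hrw ha with rfl | ha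
        · exact Set.mem_insert _ _
        · exact hC (hcov.2.1 a ha)
      · exact absurd hv hv'
    · intro v hv hv'
      obtain rfl := (hI' hv).resolve_right hv'
      exact FIssuable_mono hC hI hiss
    · rintro v (rfl | rfl | hv) hv' hv''
      · exact absurd hv'' (not_mem_W_of_mem_R hr)
      · exact hwI'
      · exact absurd hv hv'
    · intro v hv hv' _
      exact .inr (.inl ((hI' hv).resolve_right hv'))
    · rintro v (rfl | rfl | hv) hv' b hb
      · exact .inr (.inl (hwf.rmw_functional hb hrw))
      · exact absurd hw (not_mem_W_of_mem_R (Rex_subset_R (hwf.rmw_sub _ _ hb).1))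
      · exact absurd hv hv'
  by_cases hwI : w ∈ I
  · exact advance I subset_rfl (Set.subset_insert _ _) hwI
      (.rmwCover hcov hrw hrC hwC (.inl ⟨hwI, rfl⟩))
  by_cases hrel : w ∈ G.Wrel
  · exact advance (insert w I) (Set.subset_insert _ _) subset_rfl (Set.mem_insert _ _)
      (.rmwCover hcov hrw hrC hwC (.inr ⟨hrel, hwI, rfl⟩))
  · exact h.canAdvance_of_issuable hiss hrel hwI

end TravConfig

/-- The uncovered events all of whose program-order predecessors are covered. -/
def nextEvents (G : Execution) (C : Set Event) : Set Event :=
  {e | e ∈ G.E ∧ e ∉ C ∧ ∀ a, G.po a e → a ∈ C}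

theorem ExecWf.exists_next (hwf : ExecWf G) {a : Event} (ha : a ∈ G.E) (haC : a ∉ C) :
    ∃ e ∈ nextEvents G C, rcl G.po e a := by
  obtain ⟨e, ⟨heE, heC, hea⟩, hmin⟩ := exists_minimal_of_finite G.po_trans G.po_irrefl
    (S := {e | e ∈ G.E ∧ e ∉ C ∧ rcl G.po e a}) (hwf.finE.subset fun _ h => h.1)
    ⟨a, ha, haC, .inl rfl⟩
  refine ⟨e, ⟨heE, heC, fun b hb => ?_⟩, hea⟩
  by_contra hbC
  refine hmin b ⟨hb.1, hbC, ?_⟩ hb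
  rcases hea with rfl | hea
  · exact .inr hb
  · exact .inr (po_trans hb hea)

namespace arSC

theorem of_rfe {a b : Event} (h : G.rfe a b) : arSC G sc a b :=
  .inl (.inl (.inl (.inl (.inl h))))

theorem of_bob {a b : Event} (h : G.bob a b) : arSC G sc a b :=
  .inl (.inl (.inl (.inl (.inr h))))

theorem of_ppo {a b : Event} (h : G.ppo a b) : arSC G sc a b :=
  .inl (.inl (.inl (.inr h)))

theorem of_detour {a b : Event} (h : G.detour a b) : arSC G sc a b :=
  .inl (.inl (.inr h))

theorem of_sc {a b : Event} (h : sc a b) : arSC G sc a b := .inl (.inr h)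

theorem of_detour_or_rfe {a b : Event} (h : (G.detour ∪ᵣ G.rfe) a b) : arSC G sc a b :=
  h.elim of_detour of_rfe

theorem of_po_Wrel {a b : Event} (h : G.po a b) (hb : b ∈ G.Wrel) : arSC G sc a b :=
  of_bob (.inl (.inl (.inl (.inl ⟨b, h, rfl, hb⟩))))

theorem of_Racq_po {a b : Event} (ha : a ∈ G.Racq) (h : G.po a b) : arSC G sc a b :=
  of_bob (.inl (.inl (.inl (.inr ⟨a, ⟨rfl, ha⟩, h⟩))))

theorem of_po_F {a b : Event} (h : G.po a b) (hb : b ∈ G.F) : arSC G sc a b :=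
  of_bob (.inl (.inl (.inr ⟨b, h, rfl, hb⟩)))

theorem of_F_po {a b : Event} (ha : a ∈ G.F) (h : G.po a b) : arSC G sc a b :=
  of_bob (.inl (.inr ⟨a, ⟨rfl, ha⟩, h⟩))

theorem of_Wrel_poloc {a b : Event} (ha : a ∈ G.Wrel) (h : G.poloc a b) (hb : b ∈ G.W) :
    arSC G sc a b :=
  of_bob (.inr ⟨a, ⟨rfl, ha⟩, b, h, rfl, hb⟩)

theorem of_Wstrong_po {a b : Event} (ha : a ∈ G.Wstrong) (h : G.po a b) (hb : b ∈ G.W) :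
    arSC G sc a b :=
  .inr ⟨a, ⟨rfl, ha⟩, b, h, rfl, hb⟩

/-- An uncovered release write or fence that is `ar`-before `m` yields a next event that is
`ar`-before `m`. -/
theorem exists_next (hwf : ExecWf G) {a m : Event} (haC : a ∉ C)
    (ha : a ∈ G.Wrel ∨ a ∈ G.F) (ham : arSC G sc a m) :
    ∃ e ∈ nextEvents G C, tcl (arSC G sc) e m := by
  obtain ⟨e, he, rfl | hea⟩ := hwf.exists_next (ha.elim And.left And.left) haC
  · exact ⟨e, he, .single ham⟩
  · exact ⟨e, he, .tail (.single (ha.elim (of_po_Wrel hea) (of_po_F hea))) ham⟩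

end arSC

/-- A traversal configuration that does not cover every event can be advanced: an
`ar`-minimal event among the next events and the unissued writes admits a step. -/
theorem TravConfig.canAdvance (h : TravConfig G sc C I) (hwf : ExecWf G) (hsc : scWf G sc)
    (hac : acyclic (arSC G sc)) (hne : ¬ G.E ⊆ C) : CanAdvance G sc C I := by
  obtain ⟨a, ha, haC⟩ := Set.not_subset.mp hne
  obtain ⟨e, he, -⟩ := hwf.exists_next ha haC
  obtain ⟨m, hm, hmin⟩ := exists_minimal_of_finite
    (r := tcl (arSC G sc)) (fun _ _ _ h h' => Relation.TransGen.trans h h') hac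
    (S := nextEvents G C ∪ G.W \ I)
    (hwf.finE.subset (Set.union_subset (fun _ h => h.1) fun _ h => h.1.1)) ⟨e, .inl he⟩
  have hcovered : ∀ a, (a ∈ G.Wrel ∨ a ∈ G.F) → arSC G sc a m → a ∈ C := by
    intro a ha ham
    by_contra haC
    obtain ⟨e, he, hem⟩ := arSC.exists_next hwf haC ha ham
    exact hmin e (.inl he) hem
  have hissued : ∀ a ∈ G.W, tcl (arSC G sc) a m → a ∈ I := fun a ha ham =>
    by_contra fun haI => hmin a (.inr ⟨ha, haI⟩) ham
  by_cases hnext : m ∈ nextEvents G C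
  · obtain ⟨hmE, hmC, hpre⟩ := hnext
    rcases mem_R_or_W_or_F hmE with hR | hW | hF
    · refine h.canAdvance_of_next_read hwf hR hmC ⟨hmE, hpre, .inr (.inl ⟨hR, fun a ham => ?_⟩)⟩
      have haW := (hwf.rf_sub _ _ ham).1
      by_cases hpo : G.po a m
      · exact h.2.2.2.1 ⟨hpre a hpo, haW⟩
      · exact hissued a haW (.single (arSC.of_rfe ⟨ham, hpo⟩))
    · exact h.canAdvance_of_next_write hwf hW hmC hpre
    · refine h.canAdvance_of_coverable ⟨hmE, hpre, ?_⟩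
        (fun b hb => not_mem_F_of_mem_R (Rex_subset_R (hwf.rmw_sub _ _ hb).1) hF) hmC
        (fun hW => absurd hF (not_mem_F_of_mem_W hW))
      by_cases hFsc : m ∈ G.Fsc
      · exact .inr (.inr (.inr ⟨hFsc, fun a ham =>
          hcovered a (.inr (Fsc_subset_F (hsc.1 _ _ ham).1)) (arSC.of_sc ham)⟩))
      · exact .inr (.inr (.inl ⟨hF, hFsc⟩))
  · obtain ⟨hW, hmI⟩ := hm.resolve_left hnext
    have hmC : m ∉ C := fun hmC => hmI (h.2.2.2.1 ⟨hmC, hW⟩)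
    refine h.canAdvance_of_issuable ⟨hW, ?_, ?_, ?_, ?_⟩ (fun hrel => ?_) hmI
    · rintro a (⟨_, ⟨rfl, ha⟩, ham⟩ | ⟨_, ⟨rfl, ha⟩, ham⟩)
      · exact hcovered a (.inl ha) (arSC.of_Wrel_poloc ha ham hW)
      · exact hcovered a (.inr ha) (arSC.of_F_po ha ham)
    · rintro a ⟨b, hab, hbm⟩
      exact hissued a (hwf.mem_W_of_detour_or_rfe hab)
        (.tail (.single (arSC.of_detour_or_rfe hab)) (arSC.of_ppo hbm))
    · rintro a ⟨b, hab, _, ⟨rfl, hb⟩, hbm⟩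
      exact hissued a (hwf.mem_W_of_detour_or_rfe hab)
        (.tail (.single (arSC.of_detour_or_rfe hab)) (arSC.of_Racq_po hb hbm))
    · rintro a ⟨_, ⟨rfl, ha⟩, ham⟩
      exact hissued a (Wstrong_subset_W ha) (.single (arSC.of_Wstrong_po ha ham hW))
    · obtain ⟨e, he, rfl | hem⟩ := hwf.exists_next hW.1 hmC
      · exact hnext he
      · exact hmin e (.inl he) (.single (arSC.of_po_Wrel hem hrel))

end Traversal

/-- Full traversal completeness: from any traversal configuration of an
IMM_sc-consistent execution graph, the full traversal steps can reach the configuration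
in which every event is covered and every write is issued. -/
theorem full_traversal_exists (G : Execution) (sc : REv)
    (hwf : ExecWf G) (hsc : scWf G sc) (hcons : IMMscConsistent G sc)
    (C I : Set Event) (htc : TravConfig G sc C I) :
    Relation.ReflTransGen (TravStep G sc) (C, I) (G.E, G.W) := by
  induction hn : (G.E \ C).ncard + (G.W \ I).ncard using Nat.strong_induction_on
    generalizing C I with
  | _ n ih =>
    by_cases hE : G.E ⊆ C
    · have hCE : C = G.E := htc.subset_E.antisymm hE
      have hIW : I = G.W :=
        htc.subset_W.antisymm fun w hw => htc.2.2.2.1 ⟨hE hw.1, hw⟩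
      rw [hCE, hIW]
    · obtain ⟨C', I', hstep, htc', hC, hI, hlt⟩ :=
        htc.canAdvance hwf hsc hcons.2.2.2.2.1 hE
      refine .head hstep (ih _ ?_ C' I' htc' rfl)
      have hfinE : (G.E \ C).Finite := hwf.finE.sdiff
      have hfinW : (G.W \ I).Finite := (hwf.finE.subset fun _ h => h.1).sdiff
      have hleE := Set.ncard_le_ncard (Set.sdiff_subset_sdiff_right (s := G.E) hC) hfinE
      have hleW := Set.ncard_le_ncard (Set.sdiff_subset_sdiff_right (s := G.W) hI) hfinW
      rcases not_and_or.mp hlt with hlt | hlt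
      · obtain ⟨x, hx, hxC⟩ := Set.not_subset.mp hlt
        have := Set.ncard_lt_ncard (Set.ssubset_iff_of_subset
          (Set.sdiff_subset_sdiff_right (s := G.E) hC) |>.mpr
          ⟨x, ⟨htc'.subset_E hx, hxC⟩, fun h => h.2 hx⟩) hfinE
        omega
      · obtain ⟨x, hx, hxI⟩ := Set.not_subset.mp hlt
        have := Set.ncard_lt_ncard (Set.ssubset_iff_of_subset
          (Set.sdiff_subset_sdiff_right (s := G.W) hI) |>.mpr
          ⟨x, ⟨htc'.subset_W hx, hxI⟩, fun h => h.2 hx⟩) hfinW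
        omega
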